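/- Product formula for directed Ricci curvature: let 𝐱 = (x,x') and 𝐲 = (y,y') be distinct vertices of the (α,β)-weighted Cartesian product. If x ≠ y and x' ≠ y', then κ_{(α,β)}(𝐱,𝐲) = (β/(α+β))·(d(x,y)/(d(x,y)+d'(x',y')))·κ(x,y) + (α/(α+β))·(d'(x',y')/(d(x,y)+d'(x',y')))·κ'(x',y'). If x ≠ y and x' = y', then κ_{(α,β)}(𝐱,𝐲) = (β/(α+β))κ(x,y). If x = y and x' ≠ y', then κ_{(α,β)}(𝐱,𝐲) = (α/(α+β))κ'(x',y'). -/

import Mathlib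

open Finset Filter Topology MeasureTheory
open scoped Classical

noncomputable section

variable {V : Type*}

/-- Vertex weight `μ(x) = Σ_y μ_{xy}`. -/
def vdeg [Fintype V] (μ : V → V → ℝ) (x : V) : ℝ := ∑ y, μ x y

/-- Transition probability kernel `P(x,y) = μ_{xy}/μ(x)`. -/
def transP [Fintype V] (μ : V → V → ℝ) (x y : V) : ℝ := μ x y / vdeg μ x

/-- `m` is the Perron measure of `(V,μ)`. -/
def IsPerron [Fintype V] (μ : V → V → ℝ) (m : V → ℝ) : Prop :=
  (∀ x, 0 < m x) ∧ (∑ x, m x = 1) ∧ ∀ x, m x = ∑ y, m y * transP μ y x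

/-- Mean transition probability kernel `𝒫 = (P + ←P)/2`. -/
def meanK [Fintype V] (μ : V → V → ℝ) (m : V → ℝ) (x y : V) : ℝ :=
  (transP μ x y + m y / m x * transP μ y x) / 2

/-- There is a directed path of length `n` from `x` to `y`. -/
def HasPathLen (μ : V → V → ℝ) (x y : V) (n : ℕ) : Prop :=
  ∃ c : ℕ → V, c 0 = x ∧ c n = y ∧ ∀ i < n, 0 < μ (c i) (c (i + 1))

/-- The (non-symmetric) graph distance. -/
def gdist (μ : V → V → ℝ) (x y : V) : ℝ :=
  sInf {r : ℝ | ∃ n : ℕ, (r : ℝ) = (n : ℝ) ∧ HasPathLen μ x y n}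

/-- The graph is simple: no loops. -/
def IsSimpleW (μ : V → V → ℝ) : Prop := ∀ x, μ x x = 0

/-- The edge weight is nonnegative. -/
def Nonneg (μ : V → V → ℝ) : Prop := ∀ x y, 0 ≤ μ x y

/-- The graph is strongly connected. -/
def StronglyConnectedW (μ : V → V → ℝ) : Prop := ∀ x y, ∃ n, HasPathLen μ x y n

/-- `π` is a coupling of the probability measures `ν₀, ν₁`. -/
def IsCoupling [Fintype V] (π : V → V → ℝ) (ν₀ ν₁ : V → ℝ) : Prop :=
  (∀ x y, 0 ≤ π x y) ∧ (∀ x, ∑ y, π x y = ν₀ x) ∧ (∀ y, ∑ x, π x y = ν₁ y)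

/-- The L¹-Wasserstein distance with cost `d`. -/
def Wass [Fintype V] (d : V → V → ℝ) (ν₀ ν₁ : V → ℝ) : ℝ :=
  sInf {c : ℝ | ∃ π, IsCoupling π ν₀ ν₁ ∧ c = ∑ x, ∑ y, d x y * π x y}

/-- The probability measure `ν^ε_x`. -/
def nu [Fintype V] (P : V → V → ℝ) (ε : ℝ) (x z : V) : ℝ :=
  if z = x then 1 - ε else ε * P x z

/-- `κ_ε(x,y) = 1 − W(ν^ε_x, ν^ε_y)/d(x,y)`. -/
def kappaEps [Fintype V] (μ : V → V → ℝ) (m : V → ℝ) (ε : ℝ) (x y : V) : ℝ :=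
  1 - Wass (gdist μ) (nu (meanK μ m) ε x) (nu (meanK μ m) ε y) / gdist μ x y

/-- The (positive) Chung Laplacian associated with a kernel `P`. -/
def chungL [Fintype V] (P : V → V → ℝ) (f : V → ℝ) (x : V) : ℝ :=
  f x - ∑ y, P x y * f y

/-- The negative Laplacian `Δ = −ℒ`. -/
def negL [Fintype V] (P : V → V → ℝ) (f : V → ℝ) (x : V) : ℝ :=
  (∑ y, P x y * f y) - f x

/-- `f` is 1-Lipschitz with respect to the non-symmetric distance `d`. -/
def Lip1 (d : V → V → ℝ) (f : V → ℝ) : Prop := ∀ x y, f y - f x ≤ d x y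

/-- The asymptotic mean curvature `ℋ_x = ℒρ_x(x)`. -/
def Hout [Fintype V] (μ : V → V → ℝ) (m : V → ℝ) (x : V) : ℝ :=
  chungL (meanK μ m) (fun y => gdist μ x y) x

/-- The reverse asymptotic mean curvature `←ℋ_x = ℒ←ρ_x(x)`. -/
def Hin [Fintype V] (μ : V → V → ℝ) (m : V → ℝ) (x : V) : ℝ :=
  chungL (meanK μ m) (fun y => gdist μ y x) x

/-- The mixed asymptotic mean curvature `ℋ(x,y) = −(ℋ_x + ←ℋ_y)`. -/
def Hmix [Fintype V] (μ : V → V → ℝ) (m : V → ℝ) (x y : V) : ℝ :=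
  -(Hout μ m x + Hin μ m y)

/-- The neighborhood `𝒩_x = N_x ∪ ←N_x`. -/
def nbr [Fintype V] (μ : V → V → ℝ) (x : V) : Finset V :=
  Finset.univ.filter (fun y => 0 < μ x y ∨ 0 < μ y x)

/-- The `(α,β)`-weighted Cartesian product edge weight. -/
def prodW {V V' : Type*} [Fintype V] [Fintype V']
    (μ : V → V → ℝ) (μ' : V' → V' → ℝ) (α β : ℝ) :
    V × V' → V × V' → ℝ :=
  fun p q =>
    β * vdeg μ' p.2 * μ p.1 q.1 * (if q.2 = p.2 then 1 else 0)
      + α * vdeg μ p.1 * μ' p.2 q.2 * (if q.1 = p.1 then 1 else 0)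


section Helpers
variable {V V' : Type*}

lemma path_zero (μ : V → V → ℝ) (x : V) : HasPathLen μ x x 0 :=
  ⟨fun _ => x, rfl, rfl, fun i hi => absurd hi (Nat.not_lt_zero i)⟩

lemma path_zero_eq {μ : V → V → ℝ} {x y : V} (h : HasPathLen μ x y 0) : x = y := by
  obtain ⟨c, h0, h1, -⟩ := h
  rw [← h0, ← h1]

lemma path_cons {μ : V → V → ℝ} {x z y : V} {n : ℕ} (h : 0 < μ x z)
    (hp : HasPathLen μ z y n) : HasPathLen μ x y (n + 1) := by
  obtain ⟨c, h0, h1, h2⟩ := hp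
  refine ⟨fun i => Nat.casesOn i x c, rfl, h1, ?_⟩
  intro i hi
  cases i with
  | zero => simpa [h0] using h
  | succ j => exact h2 j (by omega)

lemma path_uncons {μ : V → V → ℝ} {x y : V} {n : ℕ} (hp : HasPathLen μ x y (n + 1)) :
    ∃ z, 0 < μ x z ∧ HasPathLen μ z y n := by
  obtain ⟨c, h0, h1, h2⟩ := hp
  refine ⟨c 1, ?_, fun i => c (i + 1), rfl, h1, fun i hi => h2 (i + 1) (by omega)⟩
  have := h2 0 (by omega)
  rwa [h0] at this

lemma path_trans {μ : V → V → ℝ} {y z : V} {k : ℕ} (hq : HasPathLen μ y z k) :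
    ∀ {n : ℕ} {x : V}, HasPathLen μ x y n → HasPathLen μ x z (n + k) := by
  intro n
  induction n with
  | zero => intro x h; rw [path_zero_eq h]; simpa using hq
  | succ n ih =>
    intro x h
    obtain ⟨w, hw, hp⟩ := path_uncons h
    have := path_cons hw (ih hp)
    rwa [show n + 1 + k = n + k + 1 by omega]

lemma gdist_spec {μ : V → V → ℝ} {x y : V} (h : ∃ n, HasPathLen μ x y n) :
    ∃ n : ℕ, gdist μ x y = n ∧ HasPathLen μ x y n ∧ ∀ k, HasPathLen μ x y k → n ≤ k := by
  refine ⟨Nat.find h, ?_, Nat.find_spec h, fun k hk => Nat.find_min' h hk⟩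
  apply IsLeast.csInf_eq
  refine ⟨⟨_, rfl, Nat.find_spec h⟩, ?_⟩
  rintro r ⟨n, rfl, hn⟩
  exact_mod_cast Nat.find_min' h hn

lemma gdist_nonneg (μ : V → V → ℝ) (x y : V) : 0 ≤ gdist μ x y := by
  apply Real.sInf_nonneg
  rintro r ⟨n, rfl, -⟩
  positivity

lemma gdist_self (μ : V → V → ℝ) (x : V) : gdist μ x x = 0 := by
  obtain ⟨n, h, -, h2⟩ := gdist_spec ⟨0, path_zero μ x⟩
  have := h2 0 (path_zero μ x)
  rw [h]; exact_mod_cast Nat.le_zero.mp this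

lemma gdist_pos {μ : V → V → ℝ} (hc : StronglyConnectedW μ) {x y : V} (hxy : x ≠ y) :
    0 < gdist μ x y := by
  obtain ⟨n, h, h1, -⟩ := gdist_spec (hc x y)
  rw [h]
  rcases Nat.eq_zero_or_pos n with rfl | hn
  · exact absurd (path_zero_eq h1) hxy
  · exact_mod_cast hn

variable [Fintype V] [Fintype V']

lemma vdeg_pos {μ : V → V → ℝ} {m : V → ℝ} (hnn : Nonneg μ) (hs : IsSimpleW μ)
    (hc : StronglyConnectedW μ) (hm : IsPerron μ m) (x : V) : 0 < vdeg μ x := by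
  have hex : ∃ y, y ≠ x := by
    by_contra hcon
    push Not at hcon
    have h := hm.2.2 x
    have h0 : ∑ y, m y * transP μ y x = 0 := by
      apply Finset.sum_eq_zero
      intro y _
      rw [hcon y, transP, hs x]; simp
    have := hm.1 x
    linarith
  obtain ⟨y, hy⟩ := hex
  obtain ⟨n, hn⟩ := hc x y
  cases n with
  | zero => exact absurd (path_zero_eq hn).symm hy
  | succ n =>
    obtain ⟨z, hz, -⟩ := path_uncons hn
    exact lt_of_lt_of_le hz
      (Finset.single_le_sum (f := fun y => μ x y) (fun y _ => hnn x y) (Finset.mem_univ z))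

lemma transP_nonneg {μ : V → V → ℝ} (hnn : Nonneg μ) (x y : V) : 0 ≤ transP μ x y :=
  div_nonneg (hnn x y) (Finset.sum_nonneg fun z _ => hnn x z)

lemma transP_sum {μ : V → V → ℝ} {x : V} (h : 0 < vdeg μ x) : ∑ y, transP μ x y = 1 := by
  simp only [transP]
  rw [← Finset.sum_div]
  exact div_self h.ne'

lemma meanK_nonneg {μ : V → V → ℝ} {m : V → ℝ} (hnn : Nonneg μ) (hm : IsPerron μ m) (x y : V) :
    0 ≤ meanK μ m x y := by
  have h1 := transP_nonneg hnn x y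
  have h2 := transP_nonneg hnn y x
  have h3 := hm.1 x
  have h4 := hm.1 y
  unfold meanK
  positivity

lemma meanK_self {μ : V → V → ℝ} {m : V → ℝ} (hs : IsSimpleW μ) (x : V) :
    meanK μ m x x = 0 := by
  simp [meanK, transP, hs x]

lemma meanK_sum {μ : V → V → ℝ} {m : V → ℝ} (hm : IsPerron μ m) {x : V} (h : 0 < vdeg μ x) :
    ∑ y, meanK μ m x y = 1 := by
  simp only [meanK]
  rw [← Finset.sum_div, Finset.sum_add_distrib, transP_sum h]
  have : ∑ y, m y / m x * transP μ y x = 1 := by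
    have h2 : ∑ y, m y / m x * transP μ y x = (∑ y, m y * transP μ y x) / m x := by
      rw [Finset.sum_div]
      exact Finset.sum_congr rfl fun y _ => by ring
    rw [h2, ← hm.2.2 x]
    exact div_self (hm.1 x).ne'
  rw [this]; norm_num

/-- A kernel with zero diagonal: `nu` as a linear expression. -/
lemma nu_eq {P : V → V → ℝ} (h0 : ∀ x, P x x = 0) (ε : ℝ) (x z : V) :
    nu P ε x z = (1 - ε) * (if z = x then 1 else 0) + ε * P x z := by
  unfold nu
  split_ifs with h
  · subst h; simp [h0]
  · simp

lemma nu_sum {P : V → V → ℝ} (h0 : ∀ x, P x x = 0) (h1 : ∀ x, ∑ y, P x y = 1) (ε : ℝ) (x : V) :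
    ∑ z, nu P ε x z = 1 := by
  simp only [nu_eq h0]
  rw [Finset.sum_add_distrib, ← Finset.mul_sum, ← Finset.mul_sum, h1]
  simp

lemma nu_nonneg {P : V → V → ℝ} (hP : ∀ x y, 0 ≤ P x y) {ε : ℝ} (h0 : 0 ≤ ε) (h1 : ε ≤ 1)
    (x z : V) : 0 ≤ nu P ε x z := by
  unfold nu
  split_ifs
  · linarith
  · exact mul_nonneg h0 (hP x z)

lemma wass_bdd {d : V → V → ℝ} (hd : ∀ x y, 0 ≤ d x y) (ν₀ ν₁ : V → ℝ) :
    ∀ c ∈ {c : ℝ | ∃ π, IsCoupling π ν₀ ν₁ ∧ c = ∑ x, ∑ y, d x y * π x y}, 0 ≤ c := by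
  rintro c ⟨π, hπ, rfl⟩
  exact Finset.sum_nonneg fun x _ => Finset.sum_nonneg fun y _ => mul_nonneg (hd x y) (hπ.1 x y)

lemma wass_nonneg {d : V → V → ℝ} (hd : ∀ x y, 0 ≤ d x y) (ν₀ ν₁ : V → ℝ) :
    0 ≤ Wass d ν₀ ν₁ := Real.sInf_nonneg (wass_bdd hd ν₀ ν₁)

lemma wass_le {d : V → V → ℝ} (hd : ∀ x y, 0 ≤ d x y) {ν₀ ν₁ : V → ℝ} {π : V → V → ℝ}
    (hπ : IsCoupling π ν₀ ν₁) : Wass d ν₀ ν₁ ≤ ∑ x, ∑ y, d x y * π x y :=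
  csInf_le ⟨0, wass_bdd hd ν₀ ν₁⟩ ⟨π, hπ, rfl⟩

lemma wass_ge {d : V → V → ℝ} {ν₀ ν₁ : V → ℝ} (hex : ∃ π, IsCoupling π ν₀ ν₁) {b : ℝ}
    (hb : ∀ π, IsCoupling π ν₀ ν₁ → b ≤ ∑ x, ∑ y, d x y * π x y) : b ≤ Wass d ν₀ ν₁ := by
  obtain ⟨π, hπ⟩ := hex
  refine le_csInf ⟨_, ⟨π, hπ, rfl⟩⟩ ?_
  rintro c ⟨π, hπ, rfl⟩
  exact hb π hπ

lemma coupling_exists {ν₀ ν₁ : V → ℝ} (h0 : ∀ x, 0 ≤ ν₀ x) (h1 : ∀ x, 0 ≤ ν₁ x)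
    (s0 : ∑ x, ν₀ x = 1) (s1 : ∑ x, ν₁ x = 1) : ∃ π, IsCoupling π ν₀ ν₁ := by
  refine ⟨fun x y => ν₀ x * ν₁ y, fun x y => mul_nonneg (h0 x) (h1 y), fun x => ?_, fun y => ?_⟩
  · rw [← Finset.mul_sum, s1, mul_one]
  · rw [← Finset.sum_mul, s0, one_mul]

lemma wass_self {d : V → V → ℝ} (hd : ∀ x y, 0 ≤ d x y) (hd0 : ∀ x, d x x = 0) {ν : V → ℝ}
    (h0 : ∀ x, 0 ≤ ν x) : Wass d ν ν = 0 := by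
  apply le_antisymm _ (wass_nonneg hd ν ν)
  have hc : IsCoupling (fun x y => if x = y then ν x else 0) ν ν := by
    refine ⟨fun x y => ?_, fun x => ?_, fun y => ?_⟩
    · dsimp only; split_ifs
      · exact h0 x
      · exact le_rfl
    · simp
    · simp
  refine (wass_le hd hc).trans (le_of_eq ?_)
  apply Finset.sum_eq_zero; intro x _
  apply Finset.sum_eq_zero; intro y _
  split_ifs with h
  · subst h; simp [hd0]
  · simp

/-- Uniqueness of the Perron measure. -/
lemma perron_unique {μ : V → V → ℝ} (hnn : Nonneg μ) (hc : StronglyConnectedW μ)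
    (hv : ∀ x, 0 < vdeg μ x) {m n : V → ℝ} (hm : IsPerron μ m) (hn : IsPerron μ n) : m = n := by
  have hne : Nonempty V := by
    by_contra h
    rw [not_nonempty_iff] at h
    have := hm.2.1
    simp at this
  obtain ⟨p, hp⟩ := Finite.exists_min (fun x => m x / n x)
  set t := m p / n p with ht
  have hnonneg : ∀ x, 0 ≤ m x - t * n x := by
    intro x
    have := hp x
    rw [le_div_iff₀ (hn.1 x)] at this
    linarith
  have hstat : ∀ x, m x - t * n x = ∑ y, (m y - t * n y) * transP μ y x := by
    intro x
    rw [hm.2.2 x, hn.2.2 x, Finset.mul_sum, ← Finset.sum_sub_distrib]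
    exact Finset.sum_congr rfl fun y _ => by ring
  have hp0 : m p - t * n p = 0 := by
    rw [ht, div_mul_cancel₀ _ (hn.1 p).ne', sub_self]
  have hstep : ∀ x y, m x - t * n x = 0 → 0 < μ y x → m y - t * n y = 0 := by
    intro x y hx hyx
    rw [hstat x] at hx
    have h := (Finset.sum_eq_zero_iff_of_nonneg (fun y _ =>
      mul_nonneg (hnonneg y) (transP_nonneg hnn y x))).1 hx y (Finset.mem_univ y)
    rcases mul_eq_zero.1 h with h | h
    · exact h
    · exact absurd h (div_pos hyx (hv y)).ne'
  have hpath : ∀ k y, HasPathLen μ y p k → m y - t * n y = 0 := by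
    intro k
    induction k with
    | zero => intro y h; rw [path_zero_eq h]; exact hp0
    | succ k ih =>
      intro y h
      obtain ⟨z, hz, hzp⟩ := path_uncons h
      exact hstep z y (ih z hzp) hz
  have hall : ∀ y, m y = t * n y := fun y => by
    obtain ⟨k, hk⟩ := hc y p
    linarith [hpath k y hk]
  have ht1 : t = 1 := by
    have h := hm.2.1
    rw [Finset.sum_congr rfl fun y _ => hall y, ← Finset.mul_sum, hn.2.1] at h
    linarith
  funext y
  rw [hall y, ht1, one_mul]

section Prod
variable {μ : V → V → ℝ} {μ' : V' → V' → ℝ} {α β : ℝ}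

lemma prodW_nonneg (hnn : Nonneg μ) (hnn' : Nonneg μ') (hα : 0 < α) (hβ : 0 < β) :
    Nonneg (prodW μ μ' α β) := by
  intro p q
  have h1 : 0 ≤ vdeg μ p.1 := Finset.sum_nonneg fun z _ => hnn _ z
  have h2 : 0 ≤ vdeg μ' p.2 := Finset.sum_nonneg fun z _ => hnn' _ z
  have h3 := hnn p.1 q.1
  have h4 := hnn' p.2 q.2
  unfold prodW
  positivity

lemma prodW_vdeg (p : V × V') :
    vdeg (prodW μ μ' α β) p = (α + β) * (vdeg μ p.1 * vdeg μ' p.2) := by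
  have h1 : ∑ q : V × V', β * vdeg μ' p.2 * μ p.1 q.1 * (if q.2 = p.2 then 1 else 0)
      = β * vdeg μ' p.2 * vdeg μ p.1 := by
    rw [Fintype.sum_prod_type]
    simp [vdeg, Finset.mul_sum]
  have h2 : ∑ q : V × V', α * vdeg μ p.1 * μ' p.2 q.2 * (if q.1 = p.1 then 1 else 0)
      = α * vdeg μ p.1 * vdeg μ' p.2 := by
    rw [Fintype.sum_prod_type, Finset.sum_comm]
    simp [vdeg, Finset.mul_sum]
  rw [vdeg]
  simp only [prodW]
  rw [Finset.sum_add_distrib, h1, h2]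
  ring

lemma prodW_transP (hα : 0 < α) (hβ : 0 < β) (hv : ∀ x, 0 < vdeg μ x)
    (hv' : ∀ x, 0 < vdeg μ' x) (p q : V × V') :
    transP (prodW μ μ' α β) p q
      = β / (α + β) * (transP μ p.1 q.1 * (if q.2 = p.2 then 1 else 0))
        + α / (α + β) * (transP μ' p.2 q.2 * (if q.1 = p.1 then 1 else 0)) := by
  have h1 := (hv p.1).ne'
  have h2 := (hv' p.2).ne'
  have h3 : α + β ≠ 0 := by positivity
  rw [transP, prodW_vdeg, prodW, transP, transP]
  field_simp

lemma prod_perron (hα : 0 < α) (hβ : 0 < β) (hv : ∀ x, 0 < vdeg μ x)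
    (hv' : ∀ x, 0 < vdeg μ' x) {m : V → ℝ} {m' : V' → ℝ} (hm : IsPerron μ m)
    (hm' : IsPerron μ' m') :
    IsPerron (prodW μ μ' α β) (fun p => m p.1 * m' p.2) := by
  refine ⟨fun p => mul_pos (hm.1 _) (hm'.1 _), ?_, ?_⟩
  · rw [Fintype.sum_prod_type]
    simp only [← Finset.mul_sum]
    rw [hm'.2.1]; simpa using hm.2.1
  · intro p
    have h3 : α + β ≠ 0 := by positivity
    simp only [prodW_transP hα hβ hv hv', mul_add]
    rw [Finset.sum_add_distrib]
    have e1 : ∑ q : V × V', m q.1 * m' q.2 *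
        (β / (α + β) * (transP μ q.1 p.1 * (if p.2 = q.2 then 1 else 0)))
        = β / (α + β) * (m p.1 * m' p.2) := by
      rw [Fintype.sum_prod_type]
      simp only [mul_ite, mul_one, mul_zero, Finset.sum_ite_eq, Finset.mem_univ, if_true]
      rw [hm.2.2 p.1, Finset.sum_mul, Finset.mul_sum]
      exact Finset.sum_congr rfl fun y _ => by ring
    have e2 : ∑ q : V × V', m q.1 * m' q.2 *
        (α / (α + β) * (transP μ' q.2 p.2 * (if p.1 = q.1 then 1 else 0)))
        = α / (α + β) * (m p.1 * m' p.2) := by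
      rw [Fintype.sum_prod_type, Finset.sum_comm]
      simp only [mul_ite, mul_one, mul_zero, Finset.sum_ite_eq, Finset.mem_univ, if_true]
      rw [hm'.2.2 p.2, Finset.mul_sum, Finset.mul_sum]
      exact Finset.sum_congr rfl fun y _ => by ring
    rw [e1, e2]
    field_simp
    ring

lemma prod_meanK (hα : 0 < α) (hβ : 0 < β) (hv : ∀ x, 0 < vdeg μ x)
    (hv' : ∀ x, 0 < vdeg μ' x) {m : V → ℝ} {m' : V' → ℝ} (hm : IsPerron μ m)
    (hm' : IsPerron μ' m') (p q : V × V') :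
    meanK (prodW μ μ' α β) (fun p => m p.1 * m' p.2) p q
      = β / (α + β) * (meanK μ m p.1 q.1 * (if q.2 = p.2 then 1 else 0))
        + α / (α + β) * (meanK μ' m' p.2 q.2 * (if q.1 = p.1 then 1 else 0)) := by
  obtain ⟨x, x'⟩ := p
  obtain ⟨y, y'⟩ := q
  have h1 := (hm.1 x).ne'
  have h2 := (hm'.1 x').ne'
  simp only [meanK, prodW_transP hα hβ hv hv', eq_comm (a := x) (b := y),
    eq_comm (a := x') (b := y')]
  by_cases hx : y = x <;> by_cases hy : y' = x'
  · subst hx; subst hy; simp [h1, h2]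
  · subst hx; simp [hy]; field_simp
  · subst hy; simp [hx]; field_simp
  · simp [hx, hy]

lemma prod_path_iff (hnn : Nonneg μ) (hnn' : Nonneg μ') (hα : 0 < α) (hβ : 0 < β)
    (hv : ∀ x, 0 < vdeg μ x) (hv' : ∀ x, 0 < vdeg μ' x) :
    ∀ (n : ℕ) (p q : V × V'), HasPathLen (prodW μ μ' α β) p q n →
      ∃ i j, i + j = n ∧ HasPathLen μ p.1 q.1 i ∧ HasPathLen μ' p.2 q.2 j := by
  intro n
  induction n with
  | zero =>
    intro p q h
    rw [path_zero_eq h]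
    exact ⟨0, 0, rfl, path_zero _ _, path_zero _ _⟩
  | succ n ih =>
    intro p q h
    obtain ⟨z, hz, hzq⟩ := path_uncons h
    obtain ⟨i, j, hij, hi, hj⟩ := ih z q hzq
    by_cases h1 : z.2 = p.2 ∧ 0 < μ p.1 z.1
    · exact ⟨i + 1, j, by omega, path_cons h1.2 hi, h1.1 ▸ hj⟩
    by_cases h2 : z.1 = p.1 ∧ 0 < μ' p.2 z.2
    · exact ⟨i, j + 1, by omega, h2.1 ▸ hi, path_cons h2.2 hj⟩
    exfalso
    have e1 : z.2 = p.2 → μ p.1 z.1 = 0 := fun e =>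
      le_antisymm (not_lt.1 fun hlt => h1 ⟨e, hlt⟩) (hnn _ _)
    have e2 : z.1 = p.1 → μ' p.2 z.2 = 0 := fun e =>
      le_antisymm (not_lt.1 fun hlt => h2 ⟨e, hlt⟩) (hnn' _ _)
    have : prodW μ μ' α β p z = 0 := by
      unfold prodW
      split_ifs with a b b
      · rw [e1 a, e2 b]; ring
      · rw [e1 a]; ring
      · rw [e2 b]; ring
      · ring
    linarith

lemma prod_path_left (hnn' : Nonneg μ') (hnn : Nonneg μ) (hα : 0 < α) (hβ : 0 < β)
    (hv : ∀ x, 0 < vdeg μ x) (hv' : ∀ x, 0 < vdeg μ' x) (x' : V') {y : V} :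
    ∀ {n : ℕ} {x : V}, HasPathLen μ x y n → HasPathLen (prodW μ μ' α β) (x, x') (y, x') n := by
  intro n
  induction n with
  | zero => intro x h; rw [path_zero_eq h]; exact path_zero _ _
  | succ n ih =>
    intro x h
    obtain ⟨z, hz, hzq⟩ := path_uncons h
    refine path_cons ?_ (ih hzq)
    have h1 := hv x
    have h2 := hv' x'
    have h3 := hnn' x' x'
    have h4 : 0 < β * vdeg μ' x' * μ x z := by positivity
    have h5 : 0 ≤ α * vdeg μ x * μ' x' x' := by positivity
    simp only [prodW, if_true, mul_one]
    split_ifs <;> linarith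

lemma prod_path_right (hnn' : Nonneg μ') (hnn : Nonneg μ) (hα : 0 < α) (hβ : 0 < β)
    (hv : ∀ x, 0 < vdeg μ x) (hv' : ∀ x, 0 < vdeg μ' x) (x : V) {y' : V'} :
    ∀ {n : ℕ} {x' : V'}, HasPathLen μ' x' y' n →
      HasPathLen (prodW μ μ' α β) (x, x') (x, y') n := by
  intro n
  induction n with
  | zero => intro x h; rw [path_zero_eq h]; exact path_zero _ _
  | succ n ih =>
    intro x' h
    obtain ⟨z, hz, hzq⟩ := path_uncons h
    refine path_cons ?_ (ih hzq)
    have h1 := hv x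
    have h2 := hv' x'
    have h3 := hnn x x
    have h4 : 0 < α * vdeg μ x * μ' x' z := by positivity
    have h5 : 0 ≤ β * vdeg μ' x' * μ x x := by positivity
    simp only [prodW, if_true, mul_one]
    split_ifs <;> linarith

lemma prod_path (hnn : Nonneg μ) (hnn' : Nonneg μ') (hα : 0 < α) (hβ : 0 < β)
    (hv : ∀ x, 0 < vdeg μ x) (hv' : ∀ x, 0 < vdeg μ' x) {x y : V} {x' y' : V'} {i j : ℕ}
    (hi : HasPathLen μ x y i) (hj : HasPathLen μ' x' y' j) :
    HasPathLen (prodW μ μ' α β) (x, x') (y, y') (i + j) :=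
  path_trans (prod_path_right hnn' hnn hα hβ hv hv' y hj)
    (prod_path_left hnn' hnn hα hβ hv hv' x' hi)

lemma prod_conn (hnn : Nonneg μ) (hnn' : Nonneg μ') (hα : 0 < α) (hβ : 0 < β)
    (hv : ∀ x, 0 < vdeg μ x) (hv' : ∀ x, 0 < vdeg μ' x)
    (hc : StronglyConnectedW μ) (hc' : StronglyConnectedW μ') :
    StronglyConnectedW (prodW μ μ' α β) := by
  rintro ⟨x, x'⟩ ⟨y, y'⟩
  obtain ⟨i, hi⟩ := hc x y
  obtain ⟨j, hj⟩ := hc' x' y'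
  exact ⟨_, prod_path hnn hnn' hα hβ hv hv' hi hj⟩

lemma prod_gdist (hnn : Nonneg μ) (hnn' : Nonneg μ') (hα : 0 < α) (hβ : 0 < β)
    (hv : ∀ x, 0 < vdeg μ x) (hv' : ∀ x, 0 < vdeg μ' x)
    (hc : StronglyConnectedW μ) (hc' : StronglyConnectedW μ') (p q : V × V') :
    gdist (prodW μ μ' α β) p q = gdist μ p.1 q.1 + gdist μ' p.2 q.2 := by
  obtain ⟨i, ei, hi, mi⟩ := gdist_spec (hc p.1 q.1)
  obtain ⟨j, ej, hj, mj⟩ := gdist_spec (hc' p.2 q.2)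
  obtain ⟨n, en, hn, mn⟩ := gdist_spec (prod_conn hnn hnn' hα hβ hv hv' hc hc' p q)
  have h1 := mn _ (prod_path hnn hnn' hα hβ hv hv' hi hj)
  obtain ⟨a, b, hab, ha, hb⟩ := prod_path_iff hnn hnn' hα hβ hv hv' n p q hn
  have h2 := mi a ha
  have h3 := mj b hb
  have h4 : n = i + j := by omega
  rw [ei, ej, en, h4]; push_cast; ring

end Prod

/-- Abstract product kernel: lower bound on the Wasserstein distance by projecting. -/
lemma wass_prod_ge {d : V → V → ℝ} {d' : V' → V' → ℝ} (hd : ∀ x y, 0 ≤ d x y)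
    (hd' : ∀ x y, 0 ≤ d' x y) {N₀ N₁ : V × V' → ℝ} {ν₀ ν₁ : V → ℝ} {ν₀' ν₁' : V' → ℝ}
    (hex : ∃ π, IsCoupling π N₀ N₁)
    (h0 : ∀ z, ∑ z', N₀ (z, z') = ν₀ z) (h1 : ∀ z, ∑ z', N₁ (z, z') = ν₁ z)
    (h0' : ∀ z', ∑ z, N₀ (z, z') = ν₀' z') (h1' : ∀ z', ∑ z, N₁ (z, z') = ν₁' z') :
    Wass d ν₀ ν₁ + Wass d' ν₀' ν₁'
      ≤ Wass (fun p q : V × V' => d p.1 q.1 + d' p.2 q.2) N₀ N₁ := by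
  refine wass_ge hex ?_
  rintro π ⟨hp, hl, hr⟩
  have c1 : IsCoupling (fun z w => ∑ z', ∑ w', π (z, z') (w, w')) ν₀ ν₁ := by
    refine ⟨fun z w => Finset.sum_nonneg fun _ _ => Finset.sum_nonneg fun _ _ => hp _ _, ?_, ?_⟩
    · intro z
      rw [← h0 z, Finset.sum_comm]
      refine Finset.sum_congr rfl fun z' _ => ?_
      rw [← hl (z, z'), Fintype.sum_prod_type]
    · intro w
      rw [← h1 w]
      simp only [← hr, Fintype.sum_prod_type]
      rw [Finset.sum_comm]
      conv_rhs => rw [Finset.sum_comm]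
      conv_lhs => rw [Finset.sum_comm]
      exact Finset.sum_congr rfl fun z _ => Finset.sum_comm
  have c2 : IsCoupling (fun z' w' => ∑ z, ∑ w, π (z, z') (w, w')) ν₀' ν₁' := by
    refine ⟨fun z w => Finset.sum_nonneg fun _ _ => Finset.sum_nonneg fun _ _ => hp _ _, ?_, ?_⟩
    · intro z'
      rw [← h0' z', Finset.sum_comm]
      refine Finset.sum_congr rfl fun z _ => ?_
      rw [← hl (z, z'), Fintype.sum_prod_type, Finset.sum_comm]
    · intro w'
      rw [← h1' w']
      simp only [← hr, Fintype.sum_prod_type]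
      conv_rhs => rw [Finset.sum_comm]
      rw [Finset.sum_comm]
      refine Finset.sum_congr rfl fun z _ => ?_
      rw [Finset.sum_comm]
  refine (add_le_add (wass_le hd c1) (wass_le hd' c2)).trans (le_of_eq ?_)
  simp only [add_mul, Finset.sum_add_distrib, Fintype.sum_prod_type]
  congr 1
  · refine Finset.sum_congr rfl fun z _ => ?_
    simp only [Finset.mul_sum]
    rw [Finset.sum_comm]
  · simp only [Finset.mul_sum]
    calc _ = ∑ z', ∑ z, ∑ w', ∑ w, d' z' w' * π (z, z') (w, w') :=
          Finset.sum_congr rfl fun _ _ => Finset.sum_comm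
      _ = ∑ z, ∑ z', ∑ w', ∑ w, d' z' w' * π (z, z') (w, w') := Finset.sum_comm
      _ = _ := Finset.sum_congr rfl fun _ _ => Finset.sum_congr rfl fun _ _ => Finset.sum_comm

/-- Upper bound: convex combinations of couplings moving one coordinate. -/
lemma wass_prod_le {d : V → V → ℝ} {d' : V' → V' → ℝ} (hd : ∀ x y, 0 ≤ d x y)
    (hd' : ∀ x y, 0 ≤ d' x y) {N₀ N₁ : V × V' → ℝ} {ν₀ ν₁ : V → ℝ} {ν₀' ν₁' : V' → ℝ}
    {x y : V} {x' y' : V'} {a b : ℝ} (ha : 0 < a) (hb : 0 < b)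
    (hex : ∃ π, IsCoupling π ν₀ ν₁) (hex' : ∃ π, IsCoupling π ν₀' ν₁')
    (s : ∑ z, ν₀ z = 1) (s' : ∑ z, ν₀' z = 1)
    (h0 : ∀ p, N₀ p = b * (ν₀ p.1 * if p.2 = x' then 1 else 0)
      + a * (ν₀' p.2 * if p.1 = x then 1 else 0))
    (h1 : ∀ p, N₁ p = b * (ν₁ p.1 * if p.2 = y' then 1 else 0)
      + a * (ν₁' p.2 * if p.1 = y then 1 else 0)) :
    Wass (fun p q : V × V' => d p.1 q.1 + d' p.2 q.2) N₀ N₁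
      ≤ b * (Wass d ν₀ ν₁ + d' x' y') + a * (d x y + Wass d' ν₀' ν₁') := by
  set W := Wass (fun p q : V × V' => d p.1 q.1 + d' p.2 q.2) N₀ N₁ with hW
  have key : ∀ π π', IsCoupling π ν₀ ν₁ → IsCoupling π' ν₀' ν₁' →
      W ≤ b * ((∑ z, ∑ w, d z w * π z w) + d' x' y')
        + a * (d x y + ∑ z, ∑ w, d' z w * π' z w) := by
    rintro π π' ⟨p, l, r⟩ ⟨p', l', r'⟩
    have c : IsCoupling (fun P Q : V × V' =>
        b * (π P.1 Q.1 * ((if P.2 = x' then 1 else 0) * (if Q.2 = y' then 1 else 0)))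
        + a * (π' P.2 Q.2 * ((if P.1 = x then 1 else 0) * (if Q.1 = y then 1 else 0)))) N₀ N₁ := by
      refine ⟨fun P Q => ?_, fun P => ?_, fun Q => ?_⟩
      · have := p P.1 Q.1
        have := p' P.2 Q.2
        positivity
      · rw [h0, Finset.sum_add_distrib, ← Finset.mul_sum, ← Finset.mul_sum]
        congr 2
        · rw [Fintype.sum_prod_type]
          simp only [mul_ite, mul_one, mul_zero, Finset.sum_ite_eq', Finset.mem_univ, if_true,
            Finset.sum_ite_irrel, Finset.sum_const_zero, l]
        · rw [Fintype.sum_prod_type, Finset.sum_comm]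
          simp only [mul_ite, mul_one, mul_zero, Finset.sum_ite_eq', Finset.mem_univ, if_true,
            Finset.sum_ite_irrel, Finset.sum_const_zero, l']
      · rw [h1, Finset.sum_add_distrib, ← Finset.mul_sum, ← Finset.mul_sum]
        congr 2
        · rw [Fintype.sum_prod_type]
          simp only [mul_ite, mul_one, mul_zero, ite_mul, one_mul, zero_mul,
            Finset.sum_ite_eq', Finset.mem_univ, if_true,
            Finset.sum_ite_irrel, Finset.sum_const_zero, r]
        · rw [Fintype.sum_prod_type, Finset.sum_comm]
          simp only [mul_ite, mul_one, mul_zero, ite_mul, one_mul, zero_mul,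
            Finset.sum_ite_eq', Finset.mem_univ, if_true,
            Finset.sum_ite_irrel, Finset.sum_const_zero, r']
    refine (wass_le (fun P Q => add_nonneg (hd _ _) (hd' _ _)) c).trans (le_of_eq ?_)
    have t : ∑ z, ∑ w, π z w = 1 := by simp only [l, s]
    have t' : ∑ z, ∑ w, π' z w = 1 := by simp only [l', s']
    simp only [mul_add, Finset.sum_add_distrib]
    have e1 : ∑ P : V × V', ∑ Q : V × V', (d P.1 Q.1 + d' P.2 Q.2) *
        (b * (π P.1 Q.1 * ((if P.2 = x' then 1 else 0) * (if Q.2 = y' then 1 else 0))))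
        = b * (∑ z, ∑ w, d z w * π z w) + b * d' x' y' := by
      have : ∀ z w, (d z w + d' x' y') * (b * π z w)
          = b * (d z w * π z w) + b * d' x' y' * π z w := fun z w => by ring
      simp only [Fintype.sum_prod_type, mul_ite, mul_one, mul_zero,
        Finset.sum_ite_eq', Finset.mem_univ, if_true,
        Finset.sum_ite_irrel, Finset.sum_const_zero, this, Finset.sum_add_distrib,
        ← Finset.mul_sum, t]
    have e2 : ∑ P : V × V', ∑ Q : V × V', (d P.1 Q.1 + d' P.2 Q.2) *
        (a * (π' P.2 Q.2 * ((if P.1 = x then 1 else 0) * (if Q.1 = y then 1 else 0))))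
        = a * d x y + a * (∑ z, ∑ w, d' z w * π' z w) := by
      have : ∀ z w, (d x y + d' z w) * (a * π' z w)
          = a * d x y * π' z w + a * (d' z w * π' z w) := fun z w => by ring
      simp only [Fintype.sum_prod_type_right, mul_ite, mul_one, mul_zero,
        Finset.sum_ite_eq', Finset.mem_univ, if_true,
        Finset.sum_ite_irrel, Finset.sum_const_zero, this, Finset.sum_add_distrib,
        ← Finset.mul_sum, t', mul_one]
    rw [e1, e2]
  have k1 : ∀ π', IsCoupling π' ν₀' ν₁' →
      (W - b * d' x' y' - a * (d x y + ∑ z, ∑ w, d' z w * π' z w)) / b ≤ Wass d ν₀ ν₁ := by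
    intro π' hπ'
    refine wass_ge hex fun π hπ => ?_
    rw [div_le_iff₀ hb]
    linarith [key π π' hπ hπ']
  have k2 : (W - b * d' x' y' - a * d x y - b * Wass d ν₀ ν₁) / a ≤ Wass d' ν₀' ν₁' := by
    refine wass_ge hex' fun π' hπ' => ?_
    rw [div_le_iff₀ ha]
    have := k1 π' hπ'
    rw [div_le_iff₀ hb] at this
    linarith
  rw [div_le_iff₀ ha] at k2
  linarith

/-- The limit of `(d - W)/ε`. -/
lemma tendsto_aux {μ : V → V → ℝ} {m : V → ℝ} (hnn : Nonneg μ) (hc : StronglyConnectedW μ)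
    (hm : IsPerron μ m) {x y : V} {k : ℝ}
    (hk : x ≠ y → Tendsto (fun ε => kappaEps μ m ε x y / ε) (𝓝[>] (0:ℝ)) (𝓝 k)) :
    Tendsto (fun ε => (gdist μ x y -
      Wass (gdist μ) (nu (meanK μ m) ε x) (nu (meanK μ m) ε y)) / ε) (𝓝[>] (0:ℝ))
      (𝓝 (gdist μ x y * k)) := by
  by_cases hxy : x = y
  · subst hxy
    rw [gdist_self, zero_mul]
    refine tendsto_const_nhds.congr' ?_
    filter_upwards [Ioo_mem_nhdsGT (zero_lt_one' ℝ)] with ε hε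
    rw [wass_self (gdist_nonneg μ) (gdist_self μ)
      (nu_nonneg (meanK_nonneg hnn hm) hε.1.le hε.2.le x)]
    simp
  · refine ((hk hxy).const_mul (gdist μ x y)).congr fun ε => ?_
    have := (gdist_pos hc hxy).ne'
    unfold kappaEps
    field_simp

lemma tendsto_scale {f : ℝ → ℝ} {l c : ℝ} (hc : 0 < c)
    (h : Tendsto (fun ε => f ε / ε) (𝓝[>] (0:ℝ)) (𝓝 l)) :
    Tendsto (fun ε => f (c * ε) / ε) (𝓝[>] (0:ℝ)) (𝓝 (c * l)) := by
  have h1 : Tendsto (fun ε : ℝ => c * ε) (𝓝[>] (0:ℝ)) (𝓝[>] (0:ℝ)) := by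
    refine tendsto_nhdsWithin_iff.2 ⟨?_, ?_⟩
    · have : Tendsto (fun ε : ℝ => c * ε) (𝓝 0) (𝓝 (c * 0)) := tendsto_id.const_mul c
      rw [mul_zero] at this
      exact this.mono_left nhdsWithin_le_nhds
    · filter_upwards [self_mem_nhdsWithin] with ε hε
      exact mul_pos hc hε
  refine ((h.comp h1).const_mul c).congr' ?_
  filter_upwards [self_mem_nhdsWithin] with ε hε
  have : ε ≠ 0 := ne_of_gt hε
  simp only [Function.comp]
  field_simp

end Helpers

/-- product formula for the directed Ricci curvature. -/
theorem prod_ricci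
    {V V' : Type*} [Fintype V] [Fintype V']
    (μ : V → V → ℝ) (μ' : V' → V' → ℝ) (m : V → ℝ) (m' : V' → ℝ)
    (hnn : Nonneg μ) (hsimple : IsSimpleW μ) (hconn : StronglyConnectedW μ)
    (hm : IsPerron μ m)
    (hnn' : Nonneg μ') (hsimple' : IsSimpleW μ') (hconn' : StronglyConnectedW μ')
    (hm' : IsPerron μ' m')
    (α β : ℝ) (hα : 0 < α) (hβ : 0 < β)
    (M : V × V' → ℝ) (hM : IsPerron (prodW μ μ' α β) M)
    (x y : V) (x' y' : V') (hne : (x, x') ≠ (y, y'))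
    (k k' kp : ℝ)
    (hk : x ≠ y → Tendsto (fun ε => kappaEps μ m ε x y / ε) (𝓝[>] (0:ℝ)) (𝓝 k))
    (hk' : x' ≠ y' → Tendsto (fun ε => kappaEps μ' m' ε x' y' / ε) (𝓝[>] (0:ℝ)) (𝓝 k'))
    (hkp : Tendsto (fun ε => kappaEps (prodW μ μ' α β) M ε (x, x') (y, y') / ε)
      (𝓝[>] (0:ℝ)) (𝓝 kp)) :
    (x ≠ y → x' ≠ y' →
      kp = β / (α + β) * (gdist μ x y / (gdist μ x y + gdist μ' x' y')) * k
        + α / (α + β) * (gdist μ' x' y' / (gdist μ x y + gdist μ' x' y')) * k') ∧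
    (x ≠ y → x' = y' → kp = β / (α + β) * k) ∧
    (x = y → x' ≠ y' → kp = α / (α + β) * k') := by
  have hv := vdeg_pos hnn hsimple hconn hm
  have hv' := vdeg_pos hnn' hsimple' hconn' hm'
  have hW := prodW_nonneg (α := α) (β := β) hnn hnn' hα hβ
  have hcP := prod_conn hnn hnn' hα hβ hv hv' hconn hconn'
  have hvP : ∀ p, 0 < vdeg (prodW μ μ' α β) p := fun p => by
    rw [prodW_vdeg]
    have := hv p.1
    have := hv' p.2
    positivity
  have hMeq : M = fun p => m p.1 * m' p.2 :=
    perron_unique hW hcP hvP hM (prod_perron hα hβ hv hv' hm hm')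
  have hKP := prod_meanK hα hβ hv hv' hm hm'
  rw [← hMeq] at hKP
  have hgd : gdist (prodW μ μ' α β)
      = fun p q : V × V' => gdist μ p.1 q.1 + gdist μ' p.2 q.2 := by
    funext p q
    exact prod_gdist hnn hnn' hα hβ hv hv' hconn hconn' p q
  obtain ⟨b, hb⟩ : ∃ b, b = β / (α + β) := ⟨_, rfl⟩
  obtain ⟨a, ha⟩ : ∃ a, a = α / (α + β) := ⟨_, rfl⟩
  rw [← ha, ← hb] at hKP ⊢
  have hb0 : 0 < b := by rw [hb]; positivity
  have ha0 : 0 < a := by rw [ha]; positivity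
  have hab : a + b = 1 := by rw [ha, hb]; field_simp
  set K := meanK μ m with hKdef
  set K' := meanK μ' m' with hKdef'
  set KP := meanK (prodW μ μ' α β) M with hKPdef
  have K0 : ∀ x, K x x = 0 := meanK_self hsimple
  have K0' : ∀ x, K' x x = 0 := meanK_self hsimple'
  have Kn : ∀ x y, 0 ≤ K x y := meanK_nonneg hnn hm
  have Kn' : ∀ x y, 0 ≤ K' x y := meanK_nonneg hnn' hm'
  have K1 : ∀ x, ∑ y, K x y = 1 := fun x => meanK_sum hm (hv x)
  have K1' : ∀ x, ∑ y, K' x y = 1 := fun x => meanK_sum hm' (hv' x)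
  have KP0 : ∀ p, KP p p = 0 := fun p => by rw [hKP, K0, K0']; ring
  have KPn : ∀ p q, 0 ≤ KP p q := meanK_nonneg hW hM
  have KP1 : ∀ p, ∑ q, KP p q = 1 := fun p => meanK_sum hM (hvP p)
  have hnuP : ∀ ε (z : V) (z' : V') (p : V × V'), nu KP ε (z, z') p
      = b * (nu K ε z p.1 * if p.2 = z' then 1 else 0)
        + a * (nu K' ε z' p.2 * if p.1 = z then 1 else 0) := by
    intro ε z z' p
    rw [nu_eq KP0, nu_eq K0, nu_eq K0', hKP]
    obtain ⟨w, w'⟩ := p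
    have : a = 1 - b := by linarith
    rw [this]
    by_cases h1 : w = z <;> by_cases h2 : w' = z' <;> simp [h1, h2] <;> ring
  have hm1 : ∀ ε z z' w, ∑ w', nu KP ε (z, z') (w, w') = nu K (b * ε) z w := by
    intro ε z z' w
    have e0 : ∑ w', nu KP ε (z, z') (w, w')
        = b * ∑ w', (nu K ε z w * if w' = z' then (1:ℝ) else 0)
          + a * ∑ w', (nu K' ε z' w' * if w = z then (1:ℝ) else 0) := by
      rw [Finset.mul_sum, Finset.mul_sum, ← Finset.sum_add_distrib]
      exact Finset.sum_congr rfl fun w' _ => hnuP ε z z' (w, w')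
    rw [e0]
    have e1 : ∑ w', (nu K ε z w * if w' = z' then (1:ℝ) else 0) = nu K ε z w := by simp
    have e2 : ∑ w', (nu K' ε z' w' * if w = z then (1:ℝ) else 0) = if w = z then 1 else 0 := by
      rw [← Finset.sum_mul, nu_sum K0' K1', one_mul]
    rw [e1, e2, nu_eq K0, nu_eq K0, show a = 1 - b by linarith]
    ring
  have hm2 : ∀ ε z z' w', ∑ w, nu KP ε (z, z') (w, w') = nu K' (a * ε) z' w' := by
    intro ε z z' w
    simp only [hnuP]
    rw [Finset.sum_add_distrib, ← Finset.mul_sum, ← Finset.mul_sum]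
    have e1 : ∑ u, (nu K' ε z' w * if u = z then (1:ℝ) else 0) = nu K' ε z' w := by simp
    have e2 : ∑ u, (nu K ε z u * if w = z' then (1:ℝ) else 0) = if w = z' then 1 else 0 := by
      rw [← Finset.sum_mul, nu_sum K0 K1, one_mul]
    rw [e1, e2, nu_eq K0', nu_eq K0', show b = 1 - a by linarith]
    ring
  have T := tendsto_aux hnn hconn hm hk
  have T' := tendsto_aux hnn' hconn' hm' hk'
  have TP := tendsto_aux hW hcP hM (fun _ => hkp)
  rw [← hKdef] at T
  rw [← hKdef'] at T'
  rw [← hKPdef, hgd] at TP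
  dsimp only at TP
  have le1 := le_of_tendsto_of_tendsto TP
    ((tendsto_scale hb0 T).add (tendsto_scale ha0 T')) (by
      filter_upwards [Ioo_mem_nhdsGT (zero_lt_one' ℝ)] with ε hε
      rw [← add_div]
      apply div_le_div_of_nonneg_right _ hε.1.le
      have := wass_prod_ge (gdist_nonneg μ) (gdist_nonneg μ')
        (coupling_exists (nu_nonneg KPn hε.1.le hε.2.le (x, x'))
          (nu_nonneg KPn hε.1.le hε.2.le (y, y')) (nu_sum KP0 KP1 _ _) (nu_sum KP0 KP1 _ _))
        (hm1 ε x x') (hm1 ε y y') (hm2 ε x x') (hm2 ε y y')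
      linarith)
  have le2 := le_of_tendsto_of_tendsto ((T.const_mul b).add (T'.const_mul a)) TP (by
      filter_upwards [Ioo_mem_nhdsGT (zero_lt_one' ℝ)] with ε hε
      rw [← mul_div_assoc, ← mul_div_assoc, ← add_div]
      apply div_le_div_of_nonneg_right _ hε.1.le
      have := wass_prod_le (gdist_nonneg μ) (gdist_nonneg μ') ha0 hb0
        (coupling_exists (nu_nonneg Kn hε.1.le hε.2.le x)
          (nu_nonneg Kn hε.1.le hε.2.le y) (nu_sum K0 K1 _ _) (nu_sum K0 K1 _ _))
        (coupling_exists (nu_nonneg Kn' hε.1.le hε.2.le x')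
          (nu_nonneg Kn' hε.1.le hε.2.le y') (nu_sum K0' K1' _ _) (nu_sum K0' K1' _ _))
        (nu_sum K0 K1 _ _) (nu_sum K0' K1' _ _) (hnuP ε x x') (hnuP ε y y')
      have e : b = 1 - a := by linarith
      rw [e] at this ⊢
      linarith)
  have main := le_antisymm le1 le2
  refine ⟨fun h h' => ?_, fun h h' => ?_, fun h h' => ?_⟩
  · have p1 := gdist_pos hconn h
    have p2 := gdist_pos hconn' h'
    field_simp
    linarith
  · have p1 := gdist_pos hconn h
    subst h'
    rw [gdist_self] at main
    apply mul_left_cancel₀ p1.ne'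
    linarith
  · have p1 := gdist_pos hconn' h'
    subst h
    rw [gdist_self] at main
    apply mul_left_cancel₀ p1.ne'
    linarith
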